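/- Let R be an integral domain, let k ≥ 2, and let x_1,…,x_{2k−2} ∈ R^k. For j = 1,…,k let α_j ∈ R^k be the generalized cross product of x_j,…,x_{j+k−2}, i.e. the unique vector such that the standard scalar product satisfies (α_j, y) = det(x_j ⋯ x_{j+k−2} y) for all y ∈ R^k, and let A ∈ R^{k×k} be the matrix with rows α_1,…,α_k. If det(x_1 ⋯ x_k) ≠ 0, then det(A) = s · ∏_{i=1}^{k−1} det(x_i ⋯ x_{i+k−1}) for some sign s ∈ {1, −1}. -/

import Mathlib

/-- The determinant of the `k × k` matrix whose columns are `v 0, …, v (k-1)`. -/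
def colDet {R : Type*} [CommRing R] {k : ℕ} (v : Fin k → (Fin k → R)) : R :=
  (Matrix.of fun r s => v s r).det

theorem colDet_rot {R : Type*} [CommRing R] (m : ℕ) (v : Fin (m+1) → (Fin (m+1) → R)) :
    colDet (fun s => v (finRotate (m+1) s))
      = ((Equiv.Perm.sign (finRotate (m+1)) : ℤ) : R) * colDet v := by
  unfold colDet
  rw [← Matrix.det_permute' (finRotate (m+1)) (Matrix.of fun r s => v s r)]
  rfl

theorem colDet_eq {R : Type*} [CommRing R] {k : ℕ} (v : Fin k → (Fin k → R)) (a b : Fin k)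
    (hab : a ≠ b) (h : v a = v b) : colDet v = 0 := by
  unfold colDet
  exact Matrix.det_zero_of_column_eq hab (fun r => by simp [h])

theorem aux {R : Type*} [CommRing R] [IsDomain R] (m : ℕ)
    (x : ℕ → (Fin (m+1) → R)) (A : Matrix (Fin (m+1)) (Fin (m+1)) R)
    (hα : ∀ (j : Fin (m+1)) (y : Fin (m+1) → R),
      (∑ r, A j r * y r) =
        colDet (fun s : Fin (m+1) => if (s : ℕ) < m then x ((j : ℕ) + (s : ℕ)) else y))
    (hx : colDet (fun s : Fin (m+1) => x s) ≠ 0) :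
    ∃ sgn : R, (sgn = 1 ∨ sgn = -1) ∧
      A.det = sgn * ∏ i : Fin m, colDet (fun t : Fin (m+1) => x ((i : ℕ) + (t : ℕ))) := by
  set σ := finRotate (m+1) with hσ
  set u : R := ((Equiv.Perm.sign σ : ℤ) : R) with hu
  have hu1 : u = 1 ∨ u = -1 := by
    rcases Int.units_eq_one_or (Equiv.Perm.sign σ) with h | h <;> simp [hu, h]
  have huu : u * u = 1 := by rcases hu1 with h | h <;> simp [h]
  set X : Matrix (Fin (m+1)) (Fin (m+1)) R := Matrix.of fun r s : Fin (m+1) => x s r with hX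
  have hXd : X.det = colDet (fun s : Fin (m+1) => x s) := rfl
  have hent : ∀ j s, (A * X) j s =
      colDet (fun t : Fin (m+1) => if (t : ℕ) < m then x ((j : ℕ) + (t : ℕ)) else x s) := by
    intro j s
    rw [← hα, Matrix.mul_apply]
    rfl
  have hσc : ∀ i : Fin m, ((σ i.castSucc : Fin (m+1)) : ℕ) = i + 1 := by
    intro i
    rw [hσ, coe_finRotate_of_ne_last (Fin.castSucc_lt_last i).ne]; rfl
  have hσl : ((σ (Fin.last m) : Fin (m+1)) : ℕ) = 0 := by
    rw [hσ, finRotate_last]; rfl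
  set B := (A * X).submatrix σ id with hB
  have hBd : B.det = u * (A.det * X.det) := by
    rw [hB, Matrix.det_permute, Matrix.det_mul]
  have htri : B.BlockTriangular OrderDual.toDual := by
    intro i s his
    have his : i < s := his
    rw [hB, Matrix.submatrix_apply, hent]
    induction i using Fin.lastCases with
    | last => exact absurd his (not_lt.2 (Fin.le_last s))
    | cast i =>
      have h1 : (i : ℕ) < s := his
      have h2 := s.2
      refine colDet_eq _ ⟨(s : ℕ) - (i + 1), by omega⟩ (Fin.last m) ?_ ?_
      · intro h
        have := congrArg Fin.val h
        simp at this
        omega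
      · have e : (i : ℕ) + 1 + ((s : ℕ) - (i + 1)) = s := by omega
        have e2 : (s : ℕ) - (i + 1) < m := by omega
        simp [hσc, e, e2]
  have hdet := Matrix.det_of_lowerTriangular B htri
  rw [Fin.prod_univ_castSucc] at hdet
  have hlast : B (Fin.last m) (Fin.last m) = X.det := by
    rw [hB, Matrix.submatrix_apply, hent, hXd]
    congr 1
    funext t
    rw [hσl]
    induction t using Fin.lastCases with
    | last => simp
    | cast t => simp
  have hdiag : ∀ i : Fin m, B i.castSucc i.castSucc =
      u * colDet (fun t : Fin (m+1) => x ((i : ℕ) + (t : ℕ))) := by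
    intro i
    rw [hB, Matrix.submatrix_apply, hent, hu,
      ← colDet_rot m (fun t : Fin (m+1) => x ((i : ℕ) + (t : ℕ)))]
    congr 1
    funext t
    rw [hσc]
    induction t using Fin.lastCases with
    | last => rw [← hσ, hσl]; simp
    | cast t => rw [← hσ, hσc]; simp [add_assoc, add_comm, add_left_comm]
  simp only [hdiag, hlast, Finset.prod_mul_distrib, Finset.prod_const, Finset.card_univ,
    Fintype.card_fin] at hdet
  rw [hBd, ← mul_assoc] at hdet
  have hX0 : X.det ≠ 0 := by rw [hXd]; exact hx
  have h3 := mul_right_cancel₀ hX0 hdet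
  refine ⟨u * u ^ m, ?_, ?_⟩
  · rw [← pow_succ']
    rcases hu1 with h | h
    · simp [h]
    · rw [h]; exact neg_one_pow_eq_or R _
  · rw [mul_assoc, ← h3, ← mul_assoc, huu, one_mul]

/-- let `R` be an integral domain, `k ≥ 2` and `x₁,…,x_{2k−2} ∈ R^k`. For
`j = 1,…,k` let `α_j` be the generalized cross product of `x_j,…,x_{j+k−2}`, i.e. the
vector with `(α_j, y) = det(x_j ⋯ x_{j+k−2} y)` for all `y`, and let `A` be the matrix
with rows `α₁,…,α_k`. If `det(x₁ ⋯ x_k) ≠ 0`, then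
`det(A) = ± ∏_{i=1}^{k−1} det(x_i ⋯ x_{i+k−1})`. -/
theorem stmt10 {R : Type*} [CommRing R] [IsDomain R] (k : ℕ) (hk : 2 ≤ k)
    (x : Fin (2 * k - 2) → (Fin k → R))
    (α : Fin k → (Fin k → R))
    (hα : ∀ (j : Fin k) (y : Fin k → R),
      (∑ r : Fin k, α j r * y r) =
        colDet (fun s : Fin k =>
          if h : (s : ℕ) < k - 1 then
            x ⟨(j : ℕ) + (s : ℕ), by have := j.2; omega⟩
          else y))
    (A : Matrix (Fin k) (Fin k) R) (hA : ∀ r s : Fin k, A r s = α r s)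
    (hx : colDet (fun s : Fin k => x ⟨(s : ℕ), by have := s.2; omega⟩) ≠ 0) :
    ∃ sgn : R, (sgn = 1 ∨ sgn = -1) ∧
      A.det = sgn * ∏ i : Fin (k - 1),
        colDet (fun t : Fin k =>
          x ⟨(i : ℕ) + (t : ℕ), by have := i.2; have := t.2; omega⟩) := by
  obtain ⟨m, rfl⟩ : ∃ m, k = m + 1 := ⟨k - 1, by omega⟩
  set x' : ℕ → (Fin (m+1) → R) := fun n => if h : n < 2 * (m+1) - 2 then x ⟨n, h⟩ else 0 with hx'
  have key : ∀ n (h : n < 2 * (m+1) - 2), x ⟨n, h⟩ = x' n := by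
    intro n h
    simp only [hx', dif_pos h]
  simp only [key, ← hA, Nat.add_sub_cancel, dite_eq_ite] at hα hx ⊢
  exact aux m x' A hα hx
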